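/- Main theorem (balls-into-bins model): Let P be the convex hull of n points chosen independently and uniformly at random from {0,1}^d. Then, with probability tending to 1 as d → ∞ (uniformly over n), the edge expansion of the graph of P is at least 1/(12d). -/

import Mathlib

open scoped BigOperators Classical

/-- A face of `P ⊆ ℝ^d`: the subset of `P` where a linear functional valid on `P`
attains the value `c₀`. -/
def IsFaceOf {d : ℕ} (P F : Set (Fin d → ℝ)) : Prop :=
  ∃ (c : Fin d → ℝ) (c₀ : ℝ), (∀ x ∈ P, ∑ i, c i * x i ≤ c₀) ∧
    F = {x ∈ P | ∑ i, c i * x i = c₀}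

/-- A vertex of `P` is a point whose singleton is a face of `P`. -/
def IsVertexOf {d : ℕ} (P : Set (Fin d → ℝ)) (v : Fin d → ℝ) : Prop := IsFaceOf P {v}

/-- An edge of `P` is a segment between two distinct points that is a face of `P`. -/
def IsEdgeOf {d : ℕ} (P : Set (Fin d → ℝ)) (u v : Fin d → ℝ) : Prop :=
  u ≠ v ∧ IsFaceOf P (segment ℝ u v)

/-- The vertex set of `P`. -/
def polyVerts {d : ℕ} (P : Set (Fin d → ℝ)) : Set (Fin d → ℝ) := {v | IsVertexOf P v}

/-- The number of edges of `P` with exactly one endpoint in `S`, counted as ordered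
pairs `(u, v)` with `u ∈ S` and `v ∉ S`, so each crossing edge is counted once. -/
noncomputable def cutCard {d : ℕ} (P S : Set (Fin d → ℝ)) : ℕ :=
  {e : (Fin d → ℝ) × (Fin d → ℝ) | IsEdgeOf P e.1 e.2 ∧ e.1 ∈ S ∧ e.2 ∉ S}.ncard

/-- The edge expansion of the graph of `P` is at least `α`. -/
def ExpansionAtLeast {d : ℕ} (P : Set (Fin d → ℝ)) (α : ℝ) : Prop :=
  ∀ S : Set (Fin d → ℝ), S ⊆ polyVerts P → S.Nonempty →
    2 * S.ncard ≤ (polyVerts P).ncard → α * S.ncard ≤ cutCard P S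

/-- The embedding of `{0,1}^d` (as `Fin d → Fin 2`) into `ℝ^d`. -/
def toCube {d : ℕ} (w : Fin d → Fin 2) : Fin d → ℝ := fun i => ((w i : ℕ) : ℝ)

section Faces

variable {d : ℕ}

theorem IsFaceOf.isExtreme {P F : Set (Fin d → ℝ)} (h : IsFaceOf P F) : IsExtreme ℝ P F := by
  obtain ⟨c, c₀, hle, rfl⟩ := h
  refine ⟨fun x hx => hx.1, ?_⟩
  rintro x hx y hy z ⟨-, hz⟩ ⟨a, b, ha, hb, hab, rfl⟩
  refine ⟨hx, le_antisymm (hle x hx) ?_⟩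
  have h₁ : ∑ i, c i * (a • x + b • y) i = a * ∑ i, c i * x i + b * ∑ i, c i * y i := by
    simp only [Finset.mul_sum, ← Finset.sum_add_distrib, Pi.add_apply, Pi.smul_apply, smul_eq_mul]
    exact Finset.sum_congr rfl fun i _ => by ring
  rw [h₁] at hz
  have h₂ : b * ∑ i, c i * y i ≤ b * c₀ := mul_le_mul_of_nonneg_left (hle y hy) hb.le
  have h₃ : b * c₀ = c₀ - a * c₀ := by linear_combination c₀ * hab
  nlinarith

theorem right_mem_extremePoints_segment (u v : Fin d → ℝ) :
    v ∈ (segment ℝ u v).extremePoints ℝ := by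
  refine ⟨right_mem_segment ℝ u v, ?_⟩
  rintro x ⟨a, b, ha, hb, hab, rfl⟩ y ⟨a', b', ha', hb', hab', rfl⟩ ⟨s, t, hs, ht, hst, h⟩
  obtain rfl : b = 1 - a := by linarith
  obtain rfl : b' = 1 - a' := by linarith
  obtain rfl : t = 1 - s := by linarith
  have key : (s * a + (1 - s) * a') • (u - v) = 0 := by
    have : (s * a + (1 - s) * a') • (u - v) =
        s • (a • u + (1 - a) • v) + (1 - s) • (a' • u + (1 - a') • v) - v := by module
    rw [this, h, sub_self]
  rcases smul_eq_zero.1 key with h₀ | h₀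
  · have : s * a = 0 := by nlinarith [mul_nonneg hs.le ha, mul_nonneg ht.le ha']
    obtain rfl : a = 0 := by simpa [hs.ne'] using this
    simp
  · rw [sub_eq_zero.1 h₀, ← add_smul, hab, one_smul]

/-- The endpoints of an edge of a convex hull belong to the spanning set. -/
theorem IsEdgeOf.right_mem {V : Set (Fin d → ℝ)} {u v : Fin d → ℝ}
    (h : IsEdgeOf (convexHull ℝ V) u v) : v ∈ V :=
  extremePoints_convexHull_subset <|
    h.2.isExtreme.extremePoints_subset_extremePoints (right_mem_extremePoints_segment u v)

theorem IsEdgeOf.symm {P : Set (Fin d → ℝ)} {u v : Fin d → ℝ} (h : IsEdgeOf P u v) :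
    IsEdgeOf P v u :=
  ⟨h.1.symm, segment_symm ℝ u v ▸ h.2⟩

/-- A linear functional that is maximized over `V` exactly on `W` exposes the convex hull
of `W` as a face of the convex hull of `V`. -/
theorem isFaceOf_convexHull {V W : Finset (Fin d → ℝ)} (hWV : W ⊆ V) (c : Fin d → ℝ) (c₀ : ℝ)
    (hW : ∀ x ∈ W, c ⬝ᵥ x = c₀) (hV : ∀ x ∈ V, x ∉ W → c ⬝ᵥ x < c₀) :
    IsFaceOf (convexHull ℝ (V : Set (Fin d → ℝ))) (convexHull ℝ (W : Set (Fin d → ℝ))) := by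
  have hle : ∀ x ∈ V, c ⬝ᵥ x ≤ c₀ := fun x hx => by
    by_cases hxW : x ∈ W
    · exact (hW x hxW).le
    · exact (hV x hx hxW).le
  have hlin : IsLinearMap ℝ fun x : Fin d → ℝ => c ⬝ᵥ x :=
    ⟨dotProduct_add c, fun a x => dotProduct_smul a c x⟩
  refine ⟨c, c₀, fun x hx => ?_, Set.Subset.antisymm (fun x hx => ⟨?_, ?_⟩) ?_⟩
  · exact convexHull_min (t := {x | c ⬝ᵥ x ≤ c₀}) hle (convex_halfSpace_le hlin c₀) hx
  · exact convexHull_mono (by exact_mod_cast hWV) hx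
  · exact convexHull_min (t := {x | c ⬝ᵥ x = c₀}) hW (convex_hyperplane hlin c₀) hx
  · rintro x ⟨hx, hxc⟩
    change c ⬝ᵥ x = c₀ at hxc
    obtain ⟨w, hw₀, hw₁, rfl⟩ := Finset.mem_convexHull'.1 hx
    have hsum : ∑ y ∈ V, w y * (c₀ - c ⬝ᵥ y) = 0 := by
      rw [dotProduct_sum] at hxc
      simp only [dotProduct_smul, smul_eq_mul] at hxc
      simp only [mul_sub, Finset.sum_sub_distrib, hxc, ← Finset.sum_mul, hw₁, one_mul, sub_self]
    have hzero : ∀ y ∈ V, y ∉ W → w y = 0 := fun y hy hyW => by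
      have := (Finset.sum_eq_zero_iff_of_nonneg fun y hy =>
        mul_nonneg (hw₀ y hy) (sub_nonneg.2 (hle y hy))).1 hsum y hy
      exact (mul_eq_zero.1 this).resolve_right (sub_pos.2 (hV y hy hyW)).ne'
    refine Finset.mem_convexHull'.2 ⟨w, fun y hy => hw₀ y (hWV hy), ?_, ?_⟩
    · rw [← hw₁]
      exact Finset.sum_subset hWV hzero
    · exact Finset.sum_subset hWV fun y hy hyW => by rw [hzero y hy hyW, zero_smul]

end Faces

section CubePolytope

variable {d : ℕ}

theorem toCube_injective : Function.Injective (toCube (d := d)) := fun x y h => by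
  funext i
  have := congrFun h i
  simp only [toCube, Nat.cast_inj] at this
  exact Fin.ext this

/-- The polytope spanned by a set of points of the discrete cube. -/
noncomputable def cubeHull (X : Finset (Fin d → Fin 2)) : Set (Fin d → ℝ) :=
  convexHull ℝ (toCube '' (X : Set (Fin d → Fin 2)))

theorem cubeHull_eq (X : Finset (Fin d → Fin 2)) :
    cubeHull X = convexHull ℝ (X.image toCube : Finset (Fin d → ℝ)) := by
  rw [cubeHull, Finset.coe_image]

/-- The coefficients of the linear functional which, up to a constant, is the Hamming distance
to `v`, restricted to the coordinates in `T`. -/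
def signVec (T : Finset (Fin d)) (v : Fin d → Fin 2) : Fin d → ℝ :=
  fun i => if i ∈ T then 1 - 2 * toCube v i else 0

theorem signVec_dotProduct_sub (T : Finset (Fin d)) (v x : Fin d → Fin 2) :
    signVec T v ⬝ᵥ toCube x - signVec T v ⬝ᵥ toCube v = (T.filter fun i => x i ≠ v i).card := by
  rw [← dotProduct_sub, dotProduct, Finset.card_filter, Nat.cast_sum,
    ← Finset.sum_subset (Finset.subset_univ T)]
  · refine Finset.sum_congr rfl fun i hi => ?_
    simp only [signVec, hi, if_true, Pi.sub_apply, toCube]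
    generalize x i = a
    generalize v i = b
    fin_cases a <;> fin_cases b <;> norm_num
  · intro i _ hi
    simp [signVec, hi]

theorem signVec_lt (v x : Fin d → Fin 2) (h : x ≠ v) :
    signVec Finset.univ v ⬝ᵥ toCube v < signVec Finset.univ v ⬝ᵥ toCube x := by
  rw [← sub_pos, signVec_dotProduct_sub, Nat.cast_pos, Finset.card_pos]
  obtain ⟨i, hi⟩ := Function.ne_iff.1 h
  exact ⟨i, by simpa using hi⟩

theorem polyVerts_cubeHull (X : Finset (Fin d → Fin 2)) :
    polyVerts (cubeHull X) = toCube '' (X : Set (Fin d → Fin 2)) := by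
  refine Set.Subset.antisymm (fun v hv => ?_) ?_
  · exact extremePoints_convexHull_subset (IsFaceOf.isExtreme hv).mem_extremePoints
  · rintro _ ⟨v, hv, rfl⟩
    have h := isFaceOf_convexHull (V := X.image toCube) (W := {toCube v})
      (by simpa using ⟨v, hv, rfl⟩) (-signVec Finset.univ v)
      (-(signVec Finset.univ v ⬝ᵥ toCube v)) (by simp) (by
        intro y hy hyv
        obtain ⟨x, -, rfl⟩ := Finset.mem_image.1 hy
        rw [neg_dotProduct, neg_lt_neg_iff]
        exact signVec_lt v x fun h => hyv (by simp [h]))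
    rw [← cubeHull_eq, Finset.coe_singleton, convexHull_singleton] at h
    exact h

/-- The point where the ray from `v` through `x` meets the hyperplane at (functional) distance one
from `v`. -/
noncomputable def vertexFigurePoint (v x : Fin d → Fin 2) : Fin d → ℝ :=
  (signVec Finset.univ v ⬝ᵥ toCube x - signVec Finset.univ v ⬝ᵥ toCube v)⁻¹ •
    (toCube x - toCube v)

theorem vertexFigurePoint_injOn (v : Fin d → Fin 2) :
    Set.InjOn (vertexFigurePoint v) {x | x ≠ v} := by
  intro x hx y hy h
  have hx' := inv_pos.2 (sub_pos.2 (signVec_lt v x hx))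
  have hy' := inv_pos.2 (sub_pos.2 (signVec_lt v y hy))
  have hmem : ∀ z : Fin d → Fin 2, ∀ i, z i ≠ v i ↔ (toCube z - toCube v) i ≠ 0 := fun z i => by
    simp [toCube, sub_eq_zero, Fin.ext_iff]
  have hiff : ∀ i, x i ≠ v i ↔ y i ≠ v i := fun i => by
    have hi := congrFun h i
    simp only [vertexFigurePoint, Pi.smul_apply, smul_eq_mul] at hi
    rw [hmem, hmem]
    refine not_congr ⟨fun h₀ => ?_, fun h₀ => ?_⟩
    · rw [h₀, mul_zero] at hi
      exact (mul_eq_zero.1 hi.symm).resolve_left hy'.ne'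
    · rw [h₀, mul_zero] at hi
      exact (mul_eq_zero.1 hi).resolve_left hx'.ne'
  funext i
  have := hiff i
  omega

/-- A functional that is maximized on a finite set at a point of maximal norm among all maximizers
can be perturbed so as to be maximized at that point only. -/
theorem exists_functional_unique_max {ι : Type*} (A : Finset ι) (f : ι → Fin d → ℝ)
    (hf : Set.InjOn f A) (c : Fin d → ℝ) (hA : A.Nonempty) :
    ∃ w ∈ A, (∀ x ∈ A, c ⬝ᵥ f x ≤ c ⬝ᵥ f w) ∧
      ∃ e : Fin d → ℝ, ∀ x ∈ A, x ≠ w → e ⬝ᵥ f x < e ⬝ᵥ f w := by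
  obtain ⟨w₀, hw₀, hmax₀⟩ := A.exists_max_image (fun x => c ⬝ᵥ f x) hA
  obtain ⟨w, hw, hmax⟩ := (A.filter fun x => c ⬝ᵥ f x = c ⬝ᵥ f w₀).exists_max_image
    (fun x => f x ⬝ᵥ f x) ⟨w₀, by simp [hw₀]⟩
  obtain ⟨hwA, hw⟩ := Finset.mem_filter.1 hw
  refine ⟨w, hwA, fun x hx => hw ▸ hmax₀ x hx, ?_⟩
  have hev : ∀ᶠ K : ℝ in Filter.atTop,
      ∀ x ∈ A, x ≠ w → (K • c + f w) ⬝ᵥ f x < (K • c + f w) ⬝ᵥ f w := by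
    rw [Filter.eventually_all_finset]
    intro x hx
    by_cases hxw : x = w
    · simp [hxw]
    rcases (hmax₀ x hx).lt_or_eq with hlt | heq
    · rw [← hw] at hlt
      filter_upwards [Filter.eventually_gt_atTop
        ((f w ⬝ᵥ f x - f w ⬝ᵥ f w) / (c ⬝ᵥ f w - c ⬝ᵥ f x))] with K hK _
      rw [div_lt_iff₀ (sub_pos.2 hlt)] at hK
      simp only [add_dotProduct, smul_dotProduct, smul_eq_mul]
      linarith
    · refine Filter.Eventually.of_forall fun K _ => ?_
      have h₁ := hmax x (Finset.mem_filter.2 ⟨hx, heq⟩)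
      have h₂ : 0 < (f w - f x) ⬝ᵥ (f w - f x) := by
        have hne : f w - f x ≠ 0 := sub_ne_zero.2 fun h => hxw (hf hx hwA h.symm)
        refine lt_of_le_of_ne (Finset.sum_nonneg fun i _ => mul_self_nonneg _) fun h => hne ?_
        exact dotProduct_self_eq_zero.1 h.symm
      simp only [sub_dotProduct, dotProduct_sub, dotProduct_comm (f x) (f w)] at h₂
      simp only [add_dotProduct, smul_dotProduct, smul_eq_mul, heq, hw]
      linarith
  obtain ⟨K, hK⟩ := hev.exists
  exact ⟨_, hK⟩

/-- A vertex at which a linear functional is not maximal has an improving neighbour. -/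
theorem exists_improving_edge (X : Finset (Fin d → Fin 2)) {v p : Fin d → Fin 2} (hv : v ∈ X)
    (hp : p ∈ X) (c : Fin d → ℝ) (hc : c ⬝ᵥ toCube v < c ⬝ᵥ toCube p) :
    ∃ w ∈ X, c ⬝ᵥ toCube v < c ⬝ᵥ toCube w ∧ IsEdgeOf (cubeHull X) (toCube v) (toCube w) := by
  have hpv : p ≠ v := by rintro rfl; exact hc.false
  set s := signVec Finset.univ v with hs
  have hpos : ∀ x, x ≠ v → 0 < s ⬝ᵥ toCube x - s ⬝ᵥ toCube v := fun x hx =>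
    sub_pos.2 (signVec_lt v x hx)
  have hdiff : ∀ (e : Fin d → ℝ) (x), x ≠ v → e ⬝ᵥ toCube x - e ⬝ᵥ toCube v =
      (s ⬝ᵥ toCube x - s ⬝ᵥ toCube v) * e ⬝ᵥ vertexFigurePoint v x := fun e x hx => by
    rw [vertexFigurePoint, dotProduct_smul, smul_eq_mul, mul_inv_cancel_left₀ (hpos x hx).ne',
      dotProduct_sub]
  obtain ⟨w, hw, hmax, e, he⟩ := exists_functional_unique_max (X.erase v) (vertexFigurePoint v)
    (fun x hx y hy h => vertexFigurePoint_injOn v (Finset.ne_of_mem_erase hx)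
      (Finset.ne_of_mem_erase hy) h) c ⟨p, Finset.mem_erase.2 ⟨hpv, hp⟩⟩
  obtain ⟨hwv, hwX⟩ := Finset.mem_erase.1 hw
  refine ⟨w, hwX, ?_, fun h => hwv (toCube_injective h).symm, ?_⟩
  · have h₁ : 0 < c ⬝ᵥ vertexFigurePoint v p := by
      have := hdiff c p hpv
      exact pos_of_mul_pos_right (this ▸ sub_pos.2 hc) (hpos p hpv).le
    rw [← sub_pos, hdiff c w hwv]
    exact mul_pos (hpos w hwv) (h₁.trans_le (hmax p (Finset.mem_erase.2 ⟨hpv, hp⟩)))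
  · set t := e ⬝ᵥ vertexFigurePoint v w
    have hval : ∀ x, x ≠ v → (e - t • s) ⬝ᵥ toCube x - (e - t • s) ⬝ᵥ toCube v =
        (s ⬝ᵥ toCube x - s ⬝ᵥ toCube v) * (e ⬝ᵥ vertexFigurePoint v x - t) := fun x hx => by
      have := hdiff e x hx
      simp only [sub_dotProduct, smul_dotProduct, smul_eq_mul]
      linarith
    have h := isFaceOf_convexHull (V := X.image toCube) (W := {toCube v, toCube w})
      (by
        intro y hy
        simp only [Finset.mem_insert, Finset.mem_singleton] at hy
        rcases hy with rfl | rfl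
        exacts [Finset.mem_image_of_mem _ hv, Finset.mem_image_of_mem _ hwX])
      (e - t • s) ((e - t • s) ⬝ᵥ toCube v) (by
        intro y hy
        simp only [Finset.mem_insert, Finset.mem_singleton] at hy
        rcases hy with rfl | rfl
        · rfl
        · rw [← sub_eq_zero, hval w hwv, sub_self, mul_zero]) (by
        intro y hy hyv
        obtain ⟨x, hx, rfl⟩ := Finset.mem_image.1 hy
        simp only [Finset.mem_insert, Finset.mem_singleton, toCube_injective.eq_iff,
          not_or] at hyv
        rw [← sub_neg, hval x hyv.1]
        exact mul_neg_of_pos_of_neg (hpos x hyv.1)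
          (sub_neg.2 (he x (Finset.mem_erase.2 ⟨hyv.1, hx⟩) hyv.2)))
    rw [← cubeHull_eq, Finset.coe_pair, convexHull_pair] at h
    exact h

/-- The improving neighbour can be found inside any face of the cube through `v` which contains
a better point. -/
theorem exists_improving_edge_of_agree (X : Finset (Fin d → Fin 2)) (T : Finset (Fin d))
    {v p : Fin d → Fin 2} (hv : v ∈ X) (hp : p ∈ X) (hvp : ∀ i ∈ T, p i = v i) (c : Fin d → ℝ)
    (hc : c ⬝ᵥ toCube v < c ⬝ᵥ toCube p) :
    ∃ w ∈ X, (∀ i ∈ T, w i = v i) ∧ c ⬝ᵥ toCube v < c ⬝ᵥ toCube w ∧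
      IsEdgeOf (cubeHull X) (toCube v) (toCube w) := by
  obtain ⟨K, hK₀, hK⟩ : ∃ K : ℝ, 0 ≤ K ∧ ∀ x ∈ X, c ⬝ᵥ toCube x - c ⬝ᵥ toCube v ≤ K := by
    refine ⟨∑ x ∈ X, |c ⬝ᵥ toCube x - c ⬝ᵥ toCube v|,
      Finset.sum_nonneg fun x _ => abs_nonneg _, fun x hx => ?_⟩
    exact (le_abs_self _).trans (Finset.single_le_sum
      (f := fun x => |c ⬝ᵥ toCube x - c ⬝ᵥ toCube v|) (fun x _ => abs_nonneg _) hx)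
  have hval : ∀ x, (c - K • signVec T v) ⬝ᵥ toCube x - (c - K • signVec T v) ⬝ᵥ toCube v =
      c ⬝ᵥ toCube x - c ⬝ᵥ toCube v - K * (T.filter fun i => x i ≠ v i).card := fun x => by
    rw [← signVec_dotProduct_sub]
    simp only [sub_dotProduct, smul_dotProduct, smul_eq_mul]
    ring
  obtain ⟨w, hw, hlt, hedge⟩ := exists_improving_edge X hv hp (c - K • signVec T v) (by
    rw [← sub_pos, hval p, Finset.filter_false_of_mem (by simpa using hvp)]
    simpa using hc)
  rw [← sub_pos, hval w] at hlt
  have hcard : (T.filter fun i => w i ≠ v i).card = 0 := by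
    by_contra h
    have h₁ : (1 : ℝ) ≤ (T.filter fun i => w i ≠ v i).card := by
      exact_mod_cast Nat.one_le_iff_ne_zero.2 h
    nlinarith [hK w hw]
  refine ⟨w, hw, fun i hi => ?_, ?_, hedge⟩
  · by_contra h
    exact (Finset.notMem_empty i) (Finset.card_eq_zero.1 hcard ▸ Finset.mem_filter.2 ⟨hi, h⟩)
  · rw [hcard] at hlt
    simpa using hlt

end CubePolytope

section Isoperimetry

variable {ι : Type*} [Fintype ι]

/-- The points of `A` that a translation by `z` moves out of `A`. -/
def shiftBoundary (A : Finset (ι → Fin 2)) (z : ι → Fin 2) : Finset (ι → Fin 2) :=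
  A.filter fun x => x + z ∉ A

theorem card_shiftBoundary_add_le (A : Finset (ι → Fin 2)) (y z : ι → Fin 2) :
    (shiftBoundary A (y + z)).card ≤ (shiftBoundary A y).card + (shiftBoundary A z).card := by
  have hsub : shiftBoundary A (y + z) ⊆
      shiftBoundary A y ∪ (shiftBoundary A z).image (fun x => x - y) := by
    intro x hx
    simp only [shiftBoundary, Finset.mem_union, Finset.mem_filter, Finset.mem_image] at hx ⊢
    by_cases h : x + y ∈ A
    · exact Or.inr ⟨x + y, ⟨h, by rw [add_assoc]; exact hx.2⟩, add_sub_cancel_right x y⟩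
    · exact Or.inl ⟨hx.1, h⟩
  exact (Finset.card_le_card hsub).trans ((Finset.card_union_le _ _).trans
    (Nat.add_le_add_left Finset.card_image_le _))

variable [DecidableEq ι]

theorem sum_card_shiftBoundary (A : Finset (ι → Fin 2)) :
    ∑ z, (shiftBoundary A z).card = A.card * Aᶜ.card := by
  simp only [shiftBoundary, Finset.card_filter]
  rw [Finset.sum_comm, ← smul_eq_mul, ← Finset.sum_const]
  refine Finset.sum_congr rfl fun x _ => ?_
  rw [← Finset.card_filter, ← Finset.card_map (Equiv.addLeft x).toEmbedding]
  congr 1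
  ext y
  simp only [Finset.mem_map_equiv, Finset.mem_filter, Finset.mem_univ, true_and,
    Finset.mem_compl, Equiv.addLeft_symm_apply, add_neg_cancel_left]

theorem two_mul_sum_card_shiftBoundary_single (A : Finset (ι → Fin 2)) (i : ι) :
    2 * ∑ z : ι → Fin 2, (shiftBoundary A (Pi.single i (z i))).card =
      Fintype.card (ι → Fin 2) * (shiftBoundary A (Pi.single i 1)).card := by
  have hshift : ∑ z : ι → Fin 2, (shiftBoundary A (Pi.single i (z i + 1))).card =
      ∑ z : ι → Fin 2, (shiftBoundary A (Pi.single i (z i))).card := by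
    refine Fintype.sum_equiv (Equiv.addRight (Pi.single i 1)) _ _ fun z => ?_
    simp
  have hpair : ∀ a : Fin 2, (shiftBoundary A (Pi.single i a)).card +
      (shiftBoundary A (Pi.single i (a + 1))).card = (shiftBoundary A (Pi.single i 1)).card := by
    have h₀ : shiftBoundary A 0 = ∅ := by
      simp [shiftBoundary]
    intro a
    fin_cases a <;> simp [h₀]
  rw [two_mul]
  nth_rewrite 2 [← hshift]
  rw [← Finset.sum_add_distrib, Finset.sum_congr rfl fun z _ => hpair (z i), Finset.sum_const,
    smul_eq_mul, Finset.card_univ]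

/-- The edge expansion of the discrete cube is at least one. -/
theorem card_le_sum_card_shiftBoundary (A : Finset (ι → Fin 2))
    (hA : 2 * A.card ≤ Fintype.card (ι → Fin 2)) :
    A.card ≤ ∑ i, (shiftBoundary A (Pi.single i 1)).card := by
  have h₁ : 2 * (A.card * Aᶜ.card) ≤
      Fintype.card (ι → Fin 2) * ∑ i, (shiftBoundary A (Pi.single i 1)).card := by
    rw [← sum_card_shiftBoundary, Finset.mul_sum _ _ (Fintype.card _),
      ← Finset.sum_congr rfl fun i _ => two_mul_sum_card_shiftBoundary_single A i,
      ← Finset.mul_sum, Finset.sum_comm]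
    refine Nat.mul_le_mul_left 2 (Finset.sum_le_sum fun z _ => ?_)
    have := Finset.le_sum_of_subadditive (fun z => (shiftBoundary A z).card)
      (by simp [shiftBoundary]) (card_shiftBoundary_add_le A) Finset.univ
      (fun i => Pi.single i (z i))
    rwa [Finset.univ_sum_single] at this
  have h₂ := A.card_add_card_compl
  have h₃ : 0 < Fintype.card (ι → Fin 2) := Fintype.card_pos
  nlinarith

end Isoperimetry

section Expansion

variable {d : ℕ}

/-- The edges of the polytope spanned by `X` leading from `S` to its complement. -/
noncomputable def cutEdges (X S : Finset (Fin d → Fin 2)) :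
    Finset ((Fin d → Fin 2) × (Fin d → Fin 2)) :=
  (X ×ˢ X).filter fun e =>
    IsEdgeOf (cubeHull X) (toCube e.1) (toCube e.2) ∧ e.1 ∈ S ∧ e.2 ∉ S

theorem card_cutEdges_sdiff (X S : Finset (Fin d → Fin 2)) :
    (cutEdges X (X \ S)).card ≤ (cutEdges X S).card := by
  refine Finset.card_le_card_of_injOn Prod.swap (fun e he => ?_) Prod.swap_injective.injOn
  simp only [cutEdges, Finset.coe_filter, Set.mem_ofPred_eq, Finset.mem_product,
    Finset.mem_sdiff, Prod.fst_swap, Prod.snd_swap] at he ⊢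
  exact ⟨he.1.symm, he.2.1.symm, by tauto, he.2.2.1.2⟩

theorem cutCard_cubeHull {X S : Finset (Fin d → Fin 2)} (hS : S ⊆ X) :
    cutCard (cubeHull X) (toCube '' (S : Set (Fin d → Fin 2))) = (cutEdges X S).card := by
  have h : {e : (Fin d → ℝ) × (Fin d → ℝ) | IsEdgeOf (cubeHull X) e.1 e.2 ∧
      e.1 ∈ toCube '' (S : Set (Fin d → Fin 2)) ∧ e.2 ∉ toCube '' (S : Set (Fin d → Fin 2))} =
      Prod.map toCube toCube '' (cutEdges X S : Set ((Fin d → Fin 2) × (Fin d → Fin 2))) := by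
    ext ⟨a, b⟩
    simp only [Set.mem_ofPred_eq, Set.mem_image, Finset.mem_coe, cutEdges, Finset.mem_filter,
      Finset.mem_product, Prod.exists, Prod.map_apply, Prod.mk.injEq]
    constructor
    · rintro ⟨he, ⟨u, hu, rfl⟩, hb⟩
      obtain ⟨v, hv, rfl⟩ := IsEdgeOf.right_mem he
      exact ⟨u, v, ⟨⟨hS hu, hv⟩, he, hu, fun h => hb ⟨v, h, rfl⟩⟩, rfl, rfl⟩
    · rintro ⟨u, v, ⟨-, he, hu, hv⟩, rfl, rfl⟩
      exact ⟨he, ⟨u, hu, rfl⟩, fun ⟨v', hv', h⟩ => hv (toCube_injective h ▸ hv')⟩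
  rw [cutCard, h, Set.ncard_image_of_injective _ (toCube_injective.prodMap toCube_injective),
    Set.ncard_coe_finset]

variable (X : Finset (Fin d → Fin 2)) (J : Finset (Fin d)) (S : Finset (Fin d → Fin 2))

/-- The points of `X` whose coordinates in `J` are given by `b`. -/
def bin (b : J → Fin 2) : Finset (Fin d → Fin 2) :=
  X.filter fun x => J.restrict x = b

/-- The bins contained in `S`. -/
noncomputable def fullBins : Finset (J → Fin 2) :=
  Finset.univ.filter fun b => bin X J b ⊆ S

/-- The bins that meet both `S` and its complement. -/
noncomputable def mixedBins : Finset (J → Fin 2) :=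
  Finset.univ.filter fun b => ¬ bin X J b ⊆ S ∧ ¬ Disjoint (bin X J b) S

variable {X J S}

theorem exists_cut_within_bin {b : J → Fin 2} (hb : b ∈ mixedBins X J S) :
    ∃ e ∈ cutEdges X S, (J.restrict e.1, J.restrict e.2) = (b, b) := by
  simp only [mixedBins, Finset.mem_filter, Finset.mem_univ, true_and, Finset.not_subset,
    Finset.not_disjoint_iff] at hb
  obtain ⟨⟨t₀, ht₀, ht₀S⟩, s, hs, hsS⟩ := hb
  obtain ⟨t, ht, hmin⟩ := ((bin X J b) \ S).exists_min_image
    (fun t => signVec Finset.univ s ⬝ᵥ toCube t) ⟨t₀, Finset.mem_sdiff.2 ⟨ht₀, ht₀S⟩⟩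
  simp only [bin, Finset.mem_sdiff, Finset.mem_filter] at ht hs hmin
  have hst : t ≠ s := by rintro rfl; exact ht.2 hsS
  obtain ⟨w, hw, hwJ, hlt, hedge⟩ := exists_improving_edge_of_agree X J ht.1.1 hs.1
    (fun i hi => congrFun (hs.2.trans ht.1.2.symm) ⟨i, hi⟩) (-signVec Finset.univ s)
    (by rw [neg_dotProduct, neg_dotProduct, neg_lt_neg_iff]; exact signVec_lt s t hst)
  rw [neg_dotProduct, neg_dotProduct, neg_lt_neg_iff] at hlt
  have hwb : J.restrict w = b := by
    rw [← ht.1.2]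
    exact funext fun i => hwJ i i.2
  have hwS : w ∈ S := by
    by_contra h
    exact (hmin w ⟨⟨hw, hwb⟩, h⟩).not_gt hlt
  exact ⟨(w, t), Finset.mem_filter.2 ⟨Finset.mem_product.2 ⟨hw, ht.1.1⟩, hedge.symm, hwS, ht.2⟩,
    Prod.ext hwb ht.1.2⟩

theorem exists_cut_between_bins (hne : ∀ b, (bin X J b).Nonempty) {b : J → Fin 2} {j : J}
    (hb : b ∈ shiftBoundary (fullBins X J S) (Pi.single j 1)) :
    ∃ e ∈ cutEdges X S, (J.restrict e.1, J.restrict e.2) = (b, b + Pi.single j 1) := by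
  simp only [shiftBoundary, fullBins, Finset.mem_filter, Finset.mem_univ, true_and,
    Finset.not_subset] at hb
  obtain ⟨hbS, v, hv, hvS⟩ := hb
  obtain ⟨p, hp⟩ := hne b
  simp only [bin, Finset.mem_filter] at hv hp
  have hvj : ∀ i : J, v i = b i + (Pi.single j 1 : J → Fin 2) i := fun i => congrFun hv.2 i
  have hpj : ∀ i : J, p i = b i := fun i => congrFun hp.2 i
  have hsep : ∀ x : Fin d → Fin 2, signVec {j.1} v ⬝ᵥ toCube v < signVec {j.1} v ⬝ᵥ toCube x ↔
      x j ≠ v j := fun x => by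
    rw [← sub_pos, signVec_dotProduct_sub, Nat.cast_pos, Finset.card_pos,
      Finset.filter_singleton]
    split_ifs with h <;> simp [h]
  have hne_add_one : ∀ a : Fin 2, a ≠ a + 1 := by decide
  obtain ⟨w, hw, hwJ, hlt, hedge⟩ := exists_improving_edge_of_agree X (J.erase j) hv.1 hp.1
    (fun i hi => by
      obtain ⟨hij, hiJ⟩ := Finset.mem_erase.1 hi
      have h₁ := hvj ⟨i, hiJ⟩
      have h₂ := hpj ⟨i, hiJ⟩
      rw [Pi.single_eq_of_ne (by simpa [Subtype.ext_iff] using hij), add_zero] at h₁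
      exact h₂.trans h₁.symm) (signVec {j.1} v)
    ((hsep p).2 (by rw [hpj, hvj, Pi.single_eq_same]; exact hne_add_one _))
  have hwb : J.restrict w = b := by
    funext i
    by_cases hij : i = j
    · subst hij
      have h₁ := (hsep w).1 hlt
      rw [hvj, Pi.single_eq_same] at h₁
      have : ∀ a c : Fin 2, a ≠ c + 1 → a = c := by decide
      exact this _ _ h₁
    · have h₁ := hwJ i (Finset.mem_erase.2 ⟨fun h => hij (Subtype.ext h), i.2⟩)
      rw [hvj, Pi.single_eq_of_ne hij, add_zero] at h₁
      exact h₁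
  exact ⟨(w, v), Finset.mem_filter.2 ⟨Finset.mem_product.2 ⟨hw, hv.1⟩, hedge.symm,
    hbS (Finset.mem_filter.2 ⟨hw, hwb⟩), hvS⟩, Prod.ext hwb hv.2⟩

theorem card_mixedBins_add_le (hne : ∀ b, (bin X J b).Nonempty) :
    (mixedBins X J S).card + ∑ j, (shiftBoundary (fullBins X J S) (Pi.single j 1)).card ≤
      (cutEdges X S).card := by
  have hsingle : ∀ j : J, (Pi.single j 1 : J → Fin 2) ≠ 0 := fun j => by simp
  calc
    _ = ((mixedBins X J S).disjSum (Finset.univ.sigma fun j : J =>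
          shiftBoundary (fullBins X J S) (Pi.single j 1))).card := by
      rw [Finset.card_disjSum, Finset.card_sigma]
    _ = (((mixedBins X J S).disjSum (Finset.univ.sigma fun j : J =>
          shiftBoundary (fullBins X J S) (Pi.single j 1))).image
          (Sum.elim (fun b => (b, b)) fun p => (p.2, p.2 + Pi.single p.1 1))).card := by
      refine (Finset.card_image_of_injective _ (Function.Injective.sumElim ?_ ?_ ?_)).symm
      · exact fun b b' h => (Prod.ext_iff.1 h).1
      · rintro ⟨j, b⟩ ⟨j', b'⟩ h
        obtain ⟨h₁, h₂⟩ := Prod.ext_iff.1 h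
        dsimp only at h₁ h₂
        subst h₁
        have h₃ := congrFun (add_left_cancel h₂) j
        rw [Pi.single_eq_same] at h₃
        have : j = j' := by
          by_contra hjj
          rw [Pi.single_eq_of_ne hjj] at h₃
          exact one_ne_zero h₃
        rw [this]
      · rintro b ⟨j, b'⟩ h
        obtain ⟨h₁, h₂⟩ := Prod.ext_iff.1 h
        dsimp only at h₁ h₂
        subst h₁
        exact hsingle j (left_eq_add.1 h₂)
    _ ≤ ((cutEdges X S).image fun e => (J.restrict e.1, J.restrict e.2)).card := by
      refine Finset.card_le_card fun q hq => ?_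
      obtain ⟨a, ha, rfl⟩ := Finset.mem_image.1 hq
      rw [Finset.mem_image]
      rcases a with b | ⟨j, b⟩
      · exact exists_cut_within_bin (Finset.inl_mem_disjSum.1 ha)
      · exact exists_cut_between_bins hne
          (Finset.mem_sigma.1 (Finset.inr_mem_disjSum.1 ha)).2
    _ ≤ _ := Finset.card_image_le

theorem card_le_mul_card_fullBins_add {L : ℕ} (hL : ∀ b, (bin X J b).card ≤ L) (hS : S ⊆ X) :
    S.card ≤ L * ((fullBins X J S).card + (mixedBins X J S).card) := by
  have hsub : S ⊆ (fullBins X J S ∪ mixedBins X J S).biUnion (bin X J) := fun x hx => by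
    have hxb : x ∈ bin X J (J.restrict x) := Finset.mem_filter.2 ⟨hS hx, rfl⟩
    refine Finset.mem_biUnion.2 ⟨J.restrict x, ?_, hxb⟩
    simp only [fullBins, mixedBins, Finset.mem_union, Finset.mem_filter, Finset.mem_univ,
      true_and]
    have : ¬ Disjoint (bin X J (J.restrict x)) S := Finset.not_disjoint_iff.2 ⟨x, hxb, hx⟩
    tauto
  calc
    S.card ≤ (fullBins X J S ∪ mixedBins X J S).card * L :=
      (Finset.card_le_card hsub).trans (Finset.card_biUnion_le_card_mul _ _ _ fun b _ => hL b)
    _ ≤ _ := by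
      rw [mul_comm]
      exact Nat.mul_le_mul_left L (Finset.card_union_le _ _)

theorem card_le_mul_card_cutEdges_of_fullBins {L : ℕ} (hne : ∀ b, (bin X J b).Nonempty)
    (hL : ∀ b, (bin X J b).card ≤ L) (hS : S ⊆ X)
    (hfull : 2 * (fullBins X J S).card ≤ Fintype.card (J → Fin 2)) :
    S.card ≤ L * (cutEdges X S).card := by
  refine (card_le_mul_card_fullBins_add hL hS).trans (Nat.mul_le_mul_left L ?_)
  have := card_le_sum_card_shiftBoundary _ hfull
  have := card_mixedBins_add_le (S := S) hne
  omega

/-- If every bin contains at least one and at most `L` points of `X`, then the graph of the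
polytope spanned by `X` has edge expansion at least `1 / L`. -/
theorem card_le_mul_card_cutEdges {L : ℕ} (hne : ∀ b, (bin X J b).Nonempty)
    (hL : ∀ b, (bin X J b).card ≤ L) (hS : S ⊆ X) (hhalf : 2 * S.card ≤ X.card) :
    S.card ≤ L * (cutEdges X S).card := by
  by_cases hfull : 2 * (fullBins X J S).card ≤ Fintype.card (J → Fin 2)
  · exact card_le_mul_card_cutEdges_of_fullBins hne hL hS hfull
  · have hdisj : Disjoint (fullBins X J S) (fullBins X J (X \ S)) := by
      rw [Finset.disjoint_left]
      intro b h₁ h₂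
      obtain ⟨x, hx⟩ := hne b
      simp only [fullBins, Finset.mem_filter, Finset.mem_univ, true_and] at h₁ h₂
      exact (Finset.mem_sdiff.1 (h₂ hx)).2 (h₁ hx)
    have hle := Finset.card_le_univ (fullBins X J S ∪ fullBins X J (X \ S))
    rw [Finset.card_union_of_disjoint hdisj] at hle
    have h₁ := card_le_mul_card_cutEdges_of_fullBins (S := X \ S) hne hL Finset.sdiff_subset
      (by omega)
    have h₂ := Finset.card_sdiff_add_card_eq_card hS
    have h₃ := Nat.mul_le_mul_left L (card_cutEdges_sdiff X S)
    omega

/-- The number of points in every bin controls the edge expansion. -/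
theorem expansionAtLeast_of_bins {L : ℕ} {α : ℝ} (hα : α * L ≤ 1) (hα₀ : 0 ≤ α)
    (hne : X.Nonempty → ∀ b, (bin X J b).Nonempty) (hL : ∀ b, (bin X J b).card ≤ L) :
    ExpansionAtLeast (cubeHull X) α := by
  intro S' hS' hne' hhalf
  rw [polyVerts_cubeHull] at hS' hhalf
  obtain ⟨S₀, hS₀, rfl⟩ := Set.subset_image_iff.1 hS'
  lift S₀ to Finset (Fin d → Fin 2) using X.finite_toSet.subset hS₀
  rw [Set.ncard_image_of_injective _ toCube_injective, Set.ncard_coe_finset] at hhalf ⊢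
  rw [Set.ncard_image_of_injective _ toCube_injective, Set.ncard_coe_finset] at hhalf
  have hS : S₀ ⊆ X := by exact_mod_cast hS₀
  rw [cutCard_cubeHull hS]
  have hXne : X.Nonempty := (show S₀.Nonempty by simpa using hne').mono hS
  have h : (S₀.card : ℝ) ≤ L * (cutEdges X S₀).card := by
    exact_mod_cast card_le_mul_card_cutEdges (hne hXne) hL hS hhalf
  calc
    α * S₀.card ≤ α * (L * (cutEdges X S₀).card) := mul_le_mul_of_nonneg_left h hα₀
    _ = α * L * (cutEdges X S₀).card := by ring
    _ ≤ 1 * (cutEdges X S₀).card := mul_le_mul_of_nonneg_right hα (Nat.cast_nonneg _)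
    _ = _ := one_mul _

end Expansion

section Occupancy

variable {d : ℕ}

theorem card_restrict_eq (J : Finset (Fin d)) (b : J → Fin 2) :
    (Finset.univ.filter fun x : Fin d → Fin 2 => J.restrict x = b).card = 2 ^ (d - J.card) := by
  have h : (Finset.univ.filter fun x : Fin d → Fin 2 => J.restrict x = b) =
      Fintype.piFinset fun i => if h : i ∈ J then {b ⟨i, h⟩} else Finset.univ := by
    ext x
    simp only [Finset.mem_filter, Finset.mem_univ, true_and, Fintype.mem_piFinset]
    constructor
    · rintro rfl i
      split_ifs <;> simp
    · intro hx
      funext i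
      simpa using hx i
  rw [h, Fintype.card_piFinset]
  have hcard : ∀ i : Fin d, (if h : i ∈ J then {b ⟨i, h⟩} else Finset.univ).card =
      if i ∈ J then 1 else 2 := fun i => by
    split_ifs <;> simp
  rw [Finset.prod_congr rfl fun i _ => hcard i, Finset.prod_ite, Finset.prod_const_one, one_mul,
    Finset.prod_const, Finset.filter_not, Finset.filter_univ_mem, ← Finset.compl_eq_univ_sdiff,
    Finset.card_compl, Fintype.card_fin]

theorem two_pow_sub_card (J : Finset (Fin d)) :
    (2 : ℝ) ^ (d - J.card) = 2 ^ d * (1 / 2 ^ J.card) := by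
  rw [pow_sub₀ 2 two_ne_zero (by simpa using J.card_le_univ), one_div]

/-- The probability that a given bin is empty. -/
theorem card_forall_restrict_ne_le (n : ℕ) (J : Finset (Fin d)) (b : J → Fin 2) :
    ((Finset.univ.filter fun ω : Fin n → Fin d → Fin 2 =>
      ∀ i, J.restrict (ω i) ≠ b).card : ℝ) ≤ (2 ^ d) ^ n * Real.exp (-(n / 2 ^ J.card)) := by
  have h : (Finset.univ.filter fun ω : Fin n → Fin d → Fin 2 => ∀ i, J.restrict (ω i) ≠ b) =
      Fintype.piFinset fun _ => (Finset.univ.filter fun x : Fin d → Fin 2 =>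
        J.restrict x = b)ᶜ := by
    ext ω
    simp [Fintype.mem_piFinset]
  have hle : 2 ^ (d - J.card) ≤ 2 ^ d := Nat.pow_le_pow_right two_pos (Nat.sub_le _ _)
  rw [h, Fintype.card_piFinset_const, Finset.card_compl, card_restrict_eq, Fintype.card_pi]
  simp only [Fintype.card_fin, Finset.prod_const, Finset.card_univ]
  push_cast [Nat.cast_sub hle]
  rw [two_pow_sub_card]
  have h₁ : (1 : ℝ) - 1 / 2 ^ J.card ≤ Real.exp (-(1 / 2 ^ J.card)) := by
    linarith [Real.add_one_le_exp (-(1 / 2 ^ J.card : ℝ))]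
  have h₀ : (0 : ℝ) ≤ 1 - 1 / 2 ^ J.card := by
    rw [sub_nonneg, div_le_one (by positivity)]
    exact one_le_pow₀ one_le_two
  calc
    ((2 : ℝ) ^ d - 2 ^ d * (1 / 2 ^ J.card)) ^ n = (2 ^ d) ^ n * (1 - 1 / 2 ^ J.card) ^ n := by
      rw [← mul_pow]; ring
    _ ≤ (2 ^ d) ^ n * Real.exp (-(1 / 2 ^ J.card)) ^ n := by gcongr
    _ = _ := by rw [← Real.exp_nat_mul]; congr 2; ring

/-- An exponential moment bound for the probability that a given bin has more than `L` points. -/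
theorem card_lt_card_restrict_eq_le (n : ℕ) (J : Finset (Fin d)) (b : J → Fin 2) (L : ℕ) :
    ((Finset.univ.filter fun ω : Fin n → Fin d → Fin 2 =>
      L < (Finset.univ.filter fun i => J.restrict (ω i) = b).card).card : ℝ) * 2 ^ L ≤
      (2 ^ d) ^ n * Real.exp (n / 2 ^ J.card) := by
  have hmoment : ∑ ω : Fin n → Fin d → Fin 2,
      (2 : ℝ) ^ (Finset.univ.filter fun i => J.restrict (ω i) = b).card =
      (2 ^ d + 2 ^ (d - J.card)) ^ n := by
    have h₁ : ∑ x : Fin d → Fin 2, (if J.restrict x = b then (2 : ℝ) else 1) =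
        2 ^ d + 2 ^ (d - J.card) := by
      have h₂ : ∀ x : Fin d → Fin 2, (if J.restrict x = b then (2 : ℝ) else 1) =
          1 + if J.restrict x = b then 1 else 0 := fun x => by split_ifs <;> norm_num
      simp only [h₂, Finset.sum_add_distrib, Finset.sum_boole, card_restrict_eq]
      simp
    rw [← h₁, Finset.sum_pow', Fintype.piFinset_univ]
    refine Finset.sum_congr rfl fun ω _ => ?_
    rw [Finset.prod_ite, Finset.prod_const_one, mul_one, Finset.prod_const]
  calc
    _ = ∑ ω ∈ Finset.univ.filter fun ω : Fin n → Fin d → Fin 2 =>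
          L < (Finset.univ.filter fun i => J.restrict (ω i) = b).card, (2 : ℝ) ^ L := by
      rw [Finset.sum_const, nsmul_eq_mul]
    _ ≤ ∑ ω ∈ Finset.univ.filter fun ω : Fin n → Fin d → Fin 2 =>
          L < (Finset.univ.filter fun i => J.restrict (ω i) = b).card,
          (2 : ℝ) ^ (Finset.univ.filter fun i => J.restrict (ω i) = b).card :=
      Finset.sum_le_sum fun ω hω =>
        pow_le_pow_right₀ one_le_two (Finset.mem_filter.1 hω).2.le
    _ ≤ ∑ ω : Fin n → Fin d → Fin 2,
          (2 : ℝ) ^ (Finset.univ.filter fun i => J.restrict (ω i) = b).card :=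
      Finset.sum_le_sum_of_subset_of_nonneg (Finset.filter_subset _ _) fun _ _ _ => by positivity
    _ = (2 ^ d) ^ n * (1 + 1 / 2 ^ J.card) ^ n := by
      rw [hmoment, two_pow_sub_card, ← mul_pow]; ring
    _ ≤ (2 ^ d) ^ n * Real.exp (1 / 2 ^ J.card) ^ n := by
      gcongr
      linarith [Real.add_one_le_exp (1 / 2 ^ J.card : ℝ)]
    _ = _ := by rw [← Real.exp_nat_mul]; congr 2; ring

/-- The polytope spanned by the points `ω i` has edge expansion at least `1 / (12 d)`. -/
def GoodSample {n : ℕ} (ω : Fin n → Fin d → Fin 2) : Prop :=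
  ExpansionAtLeast (convexHull ℝ (Set.range fun i : Fin n => toCube (ω i))) (1 / (12 * (d : ℝ)))

theorem goodSample_of_bins {n : ℕ} (ω : Fin n → Fin d → Fin 2) (J : Finset (Fin d))
    (hne : 0 < n → ∀ b : J → Fin 2, ∃ i, J.restrict (ω i) = b)
    (hL : ∀ b : J → Fin 2, (bin (Finset.univ.image ω) J b).card ≤ 4 * d) : GoodSample ω := by
  have hrange : convexHull ℝ (Set.range fun i : Fin n => toCube (ω i)) =
      cubeHull (Finset.univ.image ω) := by
    rw [cubeHull, Finset.coe_image, Finset.coe_univ, Set.image_univ, ← Set.range_comp]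
    rfl
  rw [GoodSample, hrange]
  refine expansionAtLeast_of_bins (J := J) (L := 4 * d) ?_ (by positivity) ?_ hL
  · push_cast
    rw [one_div_mul_eq_div]
    exact div_le_one_of_le₀ (by linarith [(Nat.cast_nonneg d : (0 : ℝ) ≤ d)]) (by positivity)
  · intro hX b
    obtain ⟨_, hx⟩ := hX
    obtain ⟨i₀, -, -⟩ := Finset.mem_image.1 hx
    obtain ⟨i, hi⟩ := hne i₀.pos b
    exact ⟨ω i, Finset.mem_filter.2 ⟨Finset.mem_image_of_mem _ (Finset.mem_univ i), hi⟩⟩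

theorem card_bin_image_le {n : ℕ} (ω : Fin n → Fin d → Fin 2) (J : Finset (Fin d))
    (b : J → Fin 2) : (bin (Finset.univ.image ω) J b).card ≤
      (Finset.univ.filter fun i => J.restrict (ω i) = b).card := by
  rw [bin, Finset.filter_image]
  exact Finset.card_image_le

theorem card_bin_univ_le_one (X : Finset (Fin d → Fin 2))
    (b : ↥(Finset.univ : Finset (Fin d)) → Fin 2) : (bin X Finset.univ b).card ≤ 1 := by
  refine Finset.card_le_one.2 fun x hx y hy => funext fun i => ?_
  have h := (Finset.mem_filter.1 hx).2.trans (Finset.mem_filter.1 hy).2.symm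
  exact congrFun h ⟨i, Finset.mem_univ i⟩

theorem card_pi_subtype_le (J : Finset (Fin d)) :
    (Fintype.card (J → Fin 2) : ℝ) ≤ 2 ^ d := by
  rw [Fintype.card_fun, Fintype.card_fin, Fintype.card_coe]
  push_cast
  exact pow_le_pow_right₀ one_le_two (by simpa using J.card_le_univ)

theorem sum_card_forall_restrict_ne_le {n : ℕ} (J : Finset (Fin d)) (hJ : 2 ^ J.card * d ≤ n) :
    ∑ b : J → Fin 2, ((Finset.univ.filter fun ω : Fin n → Fin d → Fin 2 =>
      ∀ i, J.restrict (ω i) ≠ b).card : ℝ) ≤ (2 / Real.exp 1) ^ d * (2 ^ d) ^ n := by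
  have hn : (d : ℝ) ≤ n / 2 ^ J.card := by
    rw [le_div_iff₀ (by positivity), mul_comm]
    exact_mod_cast hJ
  calc
    _ ≤ ∑ b : J → Fin 2, (2 ^ d : ℝ) ^ n * Real.exp (-d) :=
      Finset.sum_le_sum fun b _ => (card_forall_restrict_ne_le n J b).trans (by gcongr)
    _ = Fintype.card (J → Fin 2) * ((2 ^ d : ℝ) ^ n * Real.exp (-d)) := by
      rw [Finset.sum_const, Finset.card_univ, nsmul_eq_mul]
    _ ≤ 2 ^ d * ((2 ^ d : ℝ) ^ n * Real.exp (-d)) := by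
      gcongr
      exact card_pi_subtype_le J
    _ = _ := by
      rw [div_pow, Real.exp_neg, ← Real.exp_nat_mul, mul_one]
      ring

theorem sum_card_lt_card_restrict_eq_le {n : ℕ} (J : Finset (Fin d))
    (hJ : n ≤ 2 ^ J.card * (2 * d)) :
    ∑ b : J → Fin 2, ((Finset.univ.filter fun ω : Fin n → Fin d → Fin 2 =>
      4 * d < (Finset.univ.filter fun i => J.restrict (ω i) = b).card).card : ℝ) ≤
      (Real.exp 2 / 8) ^ d * (2 ^ d) ^ n := by
  have hn : (n : ℝ) / 2 ^ J.card ≤ 2 * d := by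
    rw [div_le_iff₀ (by positivity), mul_comm]
    exact_mod_cast hJ
  calc
    _ ≤ ∑ b : J → Fin 2, (2 ^ d : ℝ) ^ n * Real.exp (2 * d) / 2 ^ (4 * d) :=
      Finset.sum_le_sum fun b _ => by
        rw [le_div_iff₀ (by positivity)]
        exact (card_lt_card_restrict_eq_le n J b (4 * d)).trans (by gcongr)
    _ = Fintype.card (J → Fin 2) * ((2 ^ d : ℝ) ^ n * Real.exp (2 * d) / 2 ^ (4 * d)) := by
      rw [Finset.sum_const, Finset.card_univ, nsmul_eq_mul]
    _ ≤ 2 ^ d * ((2 ^ d : ℝ) ^ n * Real.exp (2 * d) / 2 ^ (4 * d)) := by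
      gcongr
      exact card_pi_subtype_le J
    _ = _ := by
      have h₁ : (2 : ℝ) ^ (4 * d) = 2 ^ d * 8 ^ d := by
        rw [pow_mul, ← mul_pow]; norm_num
      rw [div_pow, ← Real.exp_nat_mul, h₁, mul_comm (d : ℝ) 2]
      field_simp

theorem card_not_goodSample_le (hd : 0 < d) (n : ℕ) :
    ((Finset.univ.filter fun ω : Fin n → Fin d → Fin 2 => ¬ GoodSample ω).card : ℝ) ≤
      ((2 / Real.exp 1) ^ d + (Real.exp 2 / 8) ^ d) * (2 ^ d) ^ n := by
  have hunion : ∀ {β : Type} [Fintype β] (B C : (Fin n → Fin d → Fin 2) → β → Prop)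
      [∀ b, DecidablePred fun ω => B ω b] [∀ b, DecidablePred fun ω => C ω b],
      (∀ ω, (∀ b, ¬ B ω b) → (∀ b, ¬ C ω b) → GoodSample ω) →
      ((Finset.univ.filter fun ω : Fin n → Fin d → Fin 2 => ¬ GoodSample ω).card : ℝ) ≤
        ∑ b, ((Finset.univ.filter fun ω => B ω b).card : ℝ) +
          ∑ b, ((Finset.univ.filter fun ω => C ω b).card : ℝ) := fun {β} _ B C _ _ hgood => by
    have hsub : (Finset.univ.filter fun ω : Fin n → Fin d → Fin 2 => ¬ GoodSample ω) ⊆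
        (Finset.univ.biUnion fun b => Finset.univ.filter fun ω => B ω b) ∪
          Finset.univ.biUnion fun b => Finset.univ.filter fun ω => C ω b := fun ω hω => by
      have := mt (fun h : (∀ b, ¬ B ω b) ∧ ∀ b, ¬ C ω b => hgood ω h.1 h.2)
        (Finset.mem_filter.1 hω).2
      simp only [Finset.mem_union, Finset.mem_biUnion, Finset.mem_filter, Finset.mem_univ,
        true_and]
      by_contra! h
      exact this h
    exact_mod_cast (Finset.card_le_card hsub).trans ((Finset.card_union_le _ _).trans
      (add_le_add Finset.card_biUnion_le Finset.card_biUnion_le))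
  have hpos : (0 : ℝ) ≤ (2 / Real.exp 1) ^ d * (2 ^ d) ^ n := by positivity
  have hpos' : (0 : ℝ) ≤ (Real.exp 2 / 8) ^ d * (2 ^ d) ^ n := by positivity
  rw [add_mul]
  rcases lt_or_ge n d with hnd | hnd
  · have hall : ∀ ω : Fin n → Fin d → Fin 2, GoodSample ω := fun ω => by
      refine goodSample_of_bins ω ∅ (fun hn b => ⟨⟨0, hn⟩, Subsingleton.elim _ _⟩) fun b => ?_
      refine (card_bin_image_le ω ∅ b).trans ((Finset.card_le_univ _).trans ?_)
      rw [Fintype.card_fin]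
      omega
    rw [Finset.filter_false_of_mem (by simpa using hall)]
    simpa using add_nonneg hpos hpos'
  rcases le_or_gt (2 ^ d * d) n with hbig | hsmall
  · refine (hunion (fun ω b => ∀ i, (Finset.univ : Finset (Fin d)).restrict (ω i) ≠ b)
      (fun _ _ => False) fun ω h _ => ?_).trans (add_le_add
      (sum_card_forall_restrict_ne_le Finset.univ (by simpa using hbig)) (by simpa using hpos'))
    push Not at h
    exact goodSample_of_bins ω Finset.univ (fun _ => h) fun b =>
      (card_bin_univ_le_one _ b).trans (by omega)
  · obtain ⟨k, hk, hk₁, hk₂⟩ : ∃ k ≤ d, 2 ^ k * d ≤ n ∧ n ≤ 2 ^ k * (2 * d) := by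
      have hnd' : n / d ≠ 0 := (Nat.div_pos hnd hd).ne'
      refine ⟨Nat.log 2 (n / d), ?_, ?_, ?_⟩
      · have : n / d < 2 ^ d := Nat.div_lt_of_lt_mul (by rwa [mul_comm])
        exact (Nat.log_lt_of_lt_pow hnd' this).le
      · exact (Nat.le_div_iff_mul_le hd).1 (Nat.pow_log_le_self 2 hnd')
      · have := (Nat.div_lt_iff_lt_mul hd).1 (Nat.lt_pow_succ_log_self one_lt_two (n / d))
        rw [pow_succ, mul_assoc] at this
        exact this.le
    obtain ⟨J, -, rfl⟩ := Finset.exists_subset_card_eq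
      (show k ≤ (Finset.univ : Finset (Fin d)).card by simpa using hk)
    refine (hunion (fun ω b => ∀ i, J.restrict (ω i) ≠ b)
      (fun ω b => 4 * d < (Finset.univ.filter fun i => J.restrict (ω i) = b).card)
      fun ω h₁ h₂ => ?_).trans (add_le_add (sum_card_forall_restrict_ne_le J hk₁)
      (sum_card_lt_card_restrict_eq_le J hk₂))
    push Not at h₁ h₂
    exact goodSample_of_bins ω J (fun _ => h₁) fun b => (card_bin_image_le ω J b).trans (h₂ b)

end Occupancy

theorem tendsto_failure_bound :
    Filter.Tendsto (fun d : ℕ => (2 / Real.exp 1) ^ d + (Real.exp 2 / 8) ^ d) Filter.atTop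
      (nhds 0) := by
  have h₁ : (2 : ℝ) / Real.exp 1 < 1 := by
    rw [div_lt_one (Real.exp_pos 1)]
    linarith [Real.exp_one_gt_d9]
  have h₂ : Real.exp 2 / 8 < 1 := by
    have : Real.exp 2 = Real.exp 1 * Real.exp 1 := by rw [← Real.exp_add]; norm_num
    rw [this, div_lt_one (by norm_num)]
    nlinarith [Real.exp_one_lt_d9, Real.exp_pos 1]
  simpa using (tendsto_pow_atTop_nhds_zero_of_lt_one (by positivity) h₁).add
    (tendsto_pow_atTop_nhds_zero_of_lt_one (by positivity) h₂)

/-- Main theorem, balls-into-bins model: if `P` is the convex hull of `n` i.i.d.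
uniform points of `{0,1}^d`, then with probability tending to 1 as `d → ∞`
(uniformly in `n`), the edge expansion of the graph of `P` is at least `1/(12d)`. -/
theorem main_balls_into_bins :
    ∀ ε : ℝ, 0 < ε → ∃ D : ℕ, ∀ d : ℕ, D ≤ d → ∀ n : ℕ,
      1 - ε ≤
        (((Finset.univ : Finset (Fin n → Fin d → Fin 2)).filter
            fun ω => ExpansionAtLeast
              (convexHull ℝ (Set.range fun i : Fin n => toCube (ω i)))
              (1 / (12 * (d : ℝ)))).card : ℝ)
          / (Fintype.card (Fin n → Fin d → Fin 2)) := by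
  intro ε hε
  obtain ⟨D, hD⟩ := Filter.eventually_atTop.1
    ((tendsto_failure_bound.eventually_lt_const hε).and (Filter.eventually_gt_atTop 0))
  refine ⟨D, fun d hd n => ?_⟩
  obtain ⟨hlt, hd₀⟩ := hD d hd
  have hcard : (Fintype.card (Fin n → Fin d → Fin 2) : ℝ) = (2 ^ d) ^ n := by simp
  have hbad := card_not_goodSample_le hd₀ n
  have hsplit := Finset.card_filter_add_card_filter_not
    (s := (Finset.univ : Finset (Fin n → Fin d → Fin 2))) (p := GoodSample)
  rw [Finset.card_univ, ← Nat.cast_inj (R := ℝ), hcard, Nat.cast_add] at hsplit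
  rw [hcard, le_div_iff₀ (by positivity)]
  have hle := mul_le_mul_of_nonneg_right hlt.le (show (0 : ℝ) ≤ (2 ^ d) ^ n by positivity)
  change (1 - ε) * (2 ^ d) ^ n ≤ ((Finset.univ.filter GoodSample).card : ℝ)
  linarith
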